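/- Fix K ≥ 1, σ > 0, a budget T, and a policy interacting with a K-armed Gaussian bandit (adaptive measurable arm-selection rules I_0,…,I_{T−1} and observations y_0,…,y_{T−1}). For a mean vector ν ∈ ℝ^K, let P_ν denote the law of the full transcript (I_0, y_0, …, I_{T−1}, y_{T−1}) when the observations follow y_t ~ N(ν_{I_t}, σ²), and let N_i denote the number of rounds t < T with I_t = i. Then for any two mean vectors μ, μ' ∈ ℝ^K, KL(P_μ ‖ P_{μ'}) = ∑_{i=1}^K E_{P_μ}[N_i] · (μ_i − μ'_i)²/(2σ²). In particular, if μ and μ' differ only in arm i, then KL(P_μ ‖ P_{μ'}) = ((μ_i − μ'_i)²/(2σ²)) · E_{P_μ}[N_i]. -/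

import Mathlib

open MeasureTheory ProbabilityTheory
open scoped Classical

/-- The Kullback–Leibler divergence `KL(P‖Q)`: equal to `∫ log(dP/dQ) dP` when `P` is absolutely
continuous with respect to `Q` (and the integrand is integrable), and `+∞` otherwise. -/
noncomputable def klDiv {Ω : Type*} [MeasurableSpace Ω] (P Q : Measure Ω) : EReal :=
  if P ≪ Q ∧ Integrable (llr P Q) P then ((∫ ω, llr P Q ω ∂P : ℝ) : EReal) else ⊤

/-- The arm chosen at round `t` by the deterministic policy `select` when the full observation
sequence is `y : Fin T → ℝ` (the selection at round `t` depends only on the past observations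
`y₀,…,y_{t−1}`). -/
def armProc {K T : ℕ} (select : (t : ℕ) → (Fin t → ℝ) → Fin K)
    (y : Fin T → ℝ) (t : Fin T) : Fin K :=
  select t (fun s => y ⟨s, s.2.trans t.2⟩)

/-- The number of rounds `t < T` at which arm `i` is pulled. -/
noncomputable def pullCount {K T : ℕ} (select : (t : ℕ) → (Fin t → ℝ) → Fin K)
    (y : Fin T → ℝ) (i : Fin K) : ℕ :=
  (Finset.univ.filter fun t : Fin T => armProc select y t = i).card

/-- The law `P_ν` of the observation sequence `(y₀,…,y_{T−1})` of a `K`-armed Gaussian bandit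
with mean vector `ν` and variance `v`, under the deterministic policy `select`: at each round `t`,
the arm `I_t = armProc select y t` is chosen from the past observations and `y_t ~ N(ν_{I_t}, v)`
independently given the past; i.e., the measure with density `y ↦ ∏_t φ_{ν_{I_t(y)}, v}(y_t)`
with respect to Lebesgue measure on `ℝᵀ`. Since the arm selections are deterministic measurable
functions of the observations, this determines the law of the full transcript
`(I₀, y₀, …, I_{T−1}, y_{T−1})`. -/
noncomputable def banditLaw {K T : ℕ} (v : NNReal)
    (select : (t : ℕ) → (Fin t → ℝ) → Fin K) (ν : Fin K → ℝ) :
    Measure (Fin T → ℝ) :=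
  (Measure.pi fun _ : Fin T => (volume : Measure ℝ)).withDensity
    (fun y => ∏ t, ENNReal.ofReal (gaussianPDFReal (ν (armProc select y t)) v (y t)))

theorem armProc_snoc_castSucc {K T : ℕ} (select : (t : ℕ) → (Fin t → ℝ) → Fin K)
    (y : Fin T → ℝ) (x : ℝ) (t : Fin T) :
    armProc select (Fin.snoc y x : Fin (T + 1) → ℝ) t.castSucc = armProc select y t := by
  have h : (fun s : Fin (t : ℕ) => (Fin.snoc y x : Fin (T + 1) → ℝ) ⟨s, s.2.trans t.castSucc.2⟩)
      = fun s : Fin (t : ℕ) => y ⟨s, s.2.trans t.2⟩ := by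
    funext s
    exact Fin.snoc_castSucc (α := fun _ => ℝ) x y ⟨s, s.2.trans t.2⟩
  exact congrArg (select t) h

theorem armProc_snoc_last {K T : ℕ} (select : (t : ℕ) → (Fin t → ℝ) → Fin K)
    (y : Fin T → ℝ) (x : ℝ) :
    armProc select (Fin.snoc y x : Fin (T + 1) → ℝ) (Fin.last T) = select T y := by
  have h : (fun s : Fin T =>
      (Fin.snoc y x : Fin (T + 1) → ℝ) ⟨s, s.2.trans (Fin.last T).2⟩) = y := by
    funext s
    exact Fin.snoc_castSucc (α := fun _ => ℝ) x y s
  exact congrArg (select T) h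

theorem measurable_armProc {K T : ℕ} {select : (t : ℕ) → (Fin t → ℝ) → Fin K}
    (hsel : ∀ t, Measurable (select t)) (t : Fin T) :
    Measurable (fun y : Fin T → ℝ => armProc select y t) := by
  unfold armProc
  exact (hsel t).comp (measurable_pi_iff.2 fun s => measurable_pi_apply _)

theorem measurable_pdf_arm {α : Type*} [MeasurableSpace α] {K : ℕ} (v : NNReal) (ν : Fin K → ℝ)
    {a : α → Fin K} (ha : Measurable a) {g : α → ℝ} (hg : Measurable g) :
    Measurable (fun y => gaussianPDFReal (ν (a y)) v (g y)) := by
  have h : Measurable (fun y => ν (a y)) := (measurable_of_countable ν).comp ha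
  simp only [gaussianPDFReal]
  fun_prop

theorem measurable_density {K T : ℕ} (v : NNReal) {select : (t : ℕ) → (Fin t → ℝ) → Fin K}
    (hsel : ∀ t, Measurable (select t)) (ν : Fin K → ℝ) :
    Measurable (fun y : Fin T → ℝ =>
      ∏ t, ENNReal.ofReal (gaussianPDFReal (ν (armProc select y t)) v (y t))) := by
  refine Finset.measurable_prod _ fun t _ => ENNReal.measurable_ofReal.comp ?_
  exact measurable_pdf_arm v ν (measurable_armProc hsel t) (measurable_pi_apply t)

noncomputable def stepKernel {K T : ℕ} (v : NNReal) (s : (Fin T → ℝ) → Fin K)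
    (hs : Measurable s) (ν : Fin K → ℝ) : Kernel (Fin T → ℝ) ℝ where
  toFun y := gaussianReal (ν (s y)) v
  measurable' := (measurable_of_countable (fun i => gaussianReal (ν i) v)).comp hs

instance stepKernel_markov {K T : ℕ} (v : NNReal) (s : (Fin T → ℝ) → Fin K)
    (hs : Measurable s) (ν : Fin K → ℝ) : IsMarkovKernel (stepKernel v s hs ν) :=
  ⟨fun y => by change IsProbabilityMeasure (gaussianReal (ν (s y)) v); infer_instance⟩

theorem measurable_snoc_pair {T : ℕ} :
    Measurable (fun p : (Fin T → ℝ) × ℝ => (Fin.snoc p.1 p.2 : Fin (T + 1) → ℝ)) := by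
  refine measurable_pi_iff.2 fun j => ?_
  refine Fin.lastCases ?_ (fun j => ?_) j
  · simpa using measurable_snd
  · simpa [Function.comp_def] using (measurable_pi_apply j).comp measurable_fst

theorem lintegral_pi_snoc {T : ℕ} {F : (Fin (T + 1) → ℝ) → ENNReal} (hF : Measurable F) :
    ∫⁻ y, F y ∂(Measure.pi fun _ : Fin (T + 1) => (volume : Measure ℝ)) =
      ∫⁻ y, ∫⁻ x, F (Fin.snoc y x) ∂(volume : Measure ℝ)
        ∂(Measure.pi fun _ : Fin T => (volume : Measure ℝ)) := by
  have h := (measurePreserving_piFinSuccAbove (fun _ : Fin (T + 1) => (volume : Measure ℝ))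
    (Fin.last T)).symm
  rw [← h.lintegral_comp hF, lintegral_prod_symm' _ (by
    exact hF.comp (MeasurableEquiv.measurable _))]
  simp [MeasurableEquiv.piFinSuccAbove_symm_apply, Fin.insertNthEquiv, Fin.insertNth_last']

theorem banditLaw_succ {K T : ℕ} {v : NNReal} (hv : v ≠ 0)
    {select : (t : ℕ) → (Fin t → ℝ) → Fin K}
    (hsel : ∀ t, Measurable (select t)) (ν : Fin K → ℝ)
    [SFinite (banditLaw (T := T) v select ν)] :
    banditLaw (T := T + 1) v select ν =
      ((banditLaw (T := T) v select ν) ⊗ₘ (stepKernel v (select T) (hsel T) ν)).map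
        (fun p : (Fin T → ℝ) × ℝ => (Fin.snoc p.1 p.2 : Fin (T + 1) → ℝ)) := by
  refine Measure.ext_of_lintegral _ fun F hF => ?_
  have hFs : Measurable (fun p : (Fin T → ℝ) × ℝ => F (Fin.snoc p.1 p.2)) :=
    hF.comp (measurable_snoc_pair (T := T))
  rw [lintegral_map hF measurable_snoc_pair, Measure.lintegral_compProd hFs]
  have hin : Measurable fun y => ∫⁻ x, F (Fin.snoc y x) ∂(stepKernel v (select T) (hsel T) ν y) :=
    Measurable.lintegral_kernel_prod_right hFs
  unfold banditLaw
  rw [lintegral_withDensity_eq_lintegral_mul _ (measurable_density v hsel ν) hF,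
    lintegral_withDensity_eq_lintegral_mul _ (measurable_density v hsel ν) hin,
    lintegral_pi_snoc ((measurable_density v hsel ν).mul hF)]
  refine lintegral_congr fun y => ?_
  have hk : stepKernel v (select T) (hsel T) ν y
      = volume.withDensity (gaussianPDF (ν (select T y)) v) :=
    gaussianReal_of_var_ne_zero _ hv
  have hFy : Measurable fun x => F (Fin.snoc y x) := hFs.comp measurable_prodMk_left
  rw [Pi.mul_apply, hk,
    lintegral_withDensity_eq_lintegral_mul _ (measurable_gaussianPDF _ _) hFy,
    ← lintegral_const_mul _ ((measurable_gaussianPDF _ _).mul hFy)]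
  refine lintegral_congr fun x => ?_
  simp only [Pi.mul_apply, Fin.prod_univ_castSucc, armProc_snoc_castSucc, armProc_snoc_last,
    Fin.snoc_castSucc, Fin.snoc_last, gaussianPDF, mul_assoc]

theorem banditLaw_prob {K : ℕ} {v : NNReal} (hv : v ≠ 0)
    {select : (t : ℕ) → (Fin t → ℝ) → Fin K}
    (hsel : ∀ t, Measurable (select t)) (ν : Fin K → ℝ) (T : ℕ) :
    IsProbabilityMeasure (banditLaw (T := T) v select ν) := by
  induction T with
  | zero =>
    constructor
    simp [banditLaw]
  | succ T ih =>
    rw [banditLaw_succ hv hsel ν]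
    exact Measure.isProbabilityMeasure_map measurable_snoc_pair.aemeasurable

/-- The martingale part of the log-likelihood ratio. -/
noncomputable def martPart {K T : ℕ} (select : (t : ℕ) → (Fin t → ℝ) → Fin K)
    (μ c : Fin K → ℝ) (y : Fin T → ℝ) : ℝ :=
  ∑ t, c (armProc select y t) * (y t - μ (armProc select y t))

theorem measurable_martPart {K T : ℕ} {select : (t : ℕ) → (Fin t → ℝ) → Fin K}
    (hsel : ∀ t, Measurable (select t)) (μ c : Fin K → ℝ) :
    Measurable (martPart (T := T) select μ c) := by
  unfold martPart
  refine Finset.measurable_sum _ fun t _ => ?_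
  exact ((measurable_of_countable c).comp (measurable_armProc hsel t)).mul
    ((measurable_pi_apply t).sub ((measurable_of_countable μ).comp (measurable_armProc hsel t)))

theorem martPart_integral {K : ℕ} {v : NNReal} (hv : v ≠ 0)
    {select : (t : ℕ) → (Fin t → ℝ) → Fin K}
    (hsel : ∀ t, Measurable (select t)) (μ c : Fin K → ℝ) (T : ℕ) :
    Integrable (martPart (T := T) select μ c) (banditLaw (T := T) v select μ) ∧
      ∫ y, martPart (T := T) select μ c y ∂(banditLaw (T := T) v select μ) = 0 := by
  induction T with
  | zero =>
    have h : martPart (T := 0) select μ c = fun _ => 0 := by funext y; simp [martPart]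
    rw [h]; simp
  | succ T ih =>
    obtain ⟨ih1, ih2⟩ := ih
    have := banditLaw_prob hv hsel μ T
    have hm := measurable_martPart (T := T + 1) hsel μ c
    have hs := (hsel T)
    have hg (i : Fin K) : Integrable (fun x => c i * (x - μ i)) (gaussianReal (μ i) v) :=
      (((memLp_id_gaussianReal' 1 (by simp)).integrable le_rfl).sub
        (integrable_const _)).const_mul _
    have hid (i : Fin K) : Integrable (fun x : ℝ => x) (gaussianReal (μ i) v) :=
      (memLp_id_gaussianReal' 1 (by simp)).integrable le_rfl
    have hg0 (i : Fin K) : ∫ x, c i * (x - μ i) ∂(gaussianReal (μ i) v) = 0 := by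
      rw [integral_const_mul, integral_sub (hid i) (integrable_const _)]
      simp
    set κ := stepKernel v (select T) hs μ with hκ
    set P := banditLaw (T := T) v select μ with hP
    have hmeas : Measurable (fun p : (Fin T → ℝ) × ℝ =>
        c (select T p.1) * (p.2 - μ (select T p.1))) :=
      ((measurable_of_countable c).comp (hs.comp measurable_fst)).mul
        (measurable_snd.sub ((measurable_of_countable μ).comp (hs.comp measurable_fst)))
    have i1 : Integrable (fun p : (Fin T → ℝ) × ℝ => martPart select μ c p.1) (P ⊗ₘ κ) := by
      have : Integrable (martPart (T := T) select μ c) ((P ⊗ₘ κ).map Prod.fst) := by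
        change Integrable _ (P ⊗ₘ κ).fst
        rwa [Measure.fst_compProd]
      exact this.comp_measurable measurable_fst
    have i2 : Integrable (fun p : (Fin T → ℝ) × ℝ =>
        c (select T p.1) * (p.2 - μ (select T p.1))) (P ⊗ₘ κ) := by
      rw [Measure.integrable_compProd_iff hmeas.aestronglyMeasurable]
      refine ⟨Filter.Eventually.of_forall fun y => hg (select T y), ?_⟩
      have : Measurable (fun y => ∫ x, ‖c (select T y) * (x - μ (select T y))‖
          ∂(gaussianReal (μ (select T y)) v)) :=
        (measurable_of_countable (fun i : Fin K => ∫ x, ‖c i * (x - μ i)‖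
          ∂(gaussianReal (μ i) v))).comp hs
      refine Integrable.of_bound this.aestronglyMeasurable
        (∑ i : Fin K, ‖∫ x, ‖c i * (x - μ i)‖ ∂(gaussianReal (μ i) v)‖)
        (Filter.Eventually.of_forall fun y => ?_)
      exact Finset.single_le_sum (f := fun i : Fin K =>
        ‖∫ x, ‖c i * (x - μ i)‖ ∂(gaussianReal (μ i) v)‖) (fun i _ => norm_nonneg _)
        (Finset.mem_univ (select T y))
    have heq : (martPart (T := T + 1) select μ c) ∘
        (fun p : (Fin T → ℝ) × ℝ => (Fin.snoc p.1 p.2 : Fin (T + 1) → ℝ)) =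
        fun p => martPart select μ c p.1 + c (select T p.1) * (p.2 - μ (select T p.1)) := by
      funext p
      simp only [Function.comp, martPart, Fin.sum_univ_castSucc, armProc_snoc_castSucc,
        armProc_snoc_last, Fin.snoc_castSucc, Fin.snoc_last]
    rw [banditLaw_succ hv hsel μ]
    constructor
    · rw [integrable_map_measure hm.aestronglyMeasurable measurable_snoc_pair.aemeasurable, heq]
      exact i1.add i2
    · rw [integral_map measurable_snoc_pair.aemeasurable hm.aestronglyMeasurable]
      have := integral_add i1 i2
      rw [Measure.integral_compProd i1, Measure.integral_compProd i2] at this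
      have h2 : ∀ y, ∫ x, c (select T y) * (x - μ (select T y)) ∂(κ y) = 0 := fun y => hg0 _
      simp only [h2, integral_const, add_zero, probReal_univ, one_smul, ih2] at this
      rw [← this]
      exact integral_congr_ae (Filter.Eventually.of_forall fun p => congrFun heq p)

theorem log_pdf_sub {v : NNReal} (hv : v ≠ 0) (a b x : ℝ) :
    Real.log (gaussianPDFReal a v x) - Real.log (gaussianPDFReal b v x) =
      (a - b) / v * (x - a) + (a - b) ^ 2 / (2 * v) := by
  have hv' : (0 : ℝ) < v := by exact_mod_cast pos_iff_ne_zero.2 hv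
  have hs : (√(2 * Real.pi * v))⁻¹ ≠ 0 := by positivity
  rw [gaussianPDFReal, gaussianPDFReal, Real.log_mul hs (Real.exp_ne_zero _),
    Real.log_mul hs (Real.exp_ne_zero _), Real.log_exp, Real.log_exp]
  field_simp
  ring

theorem bandit_ac_llr {K T : ℕ} {v : NNReal} (hv : v ≠ 0)
    {select : (t : ℕ) → (Fin t → ℝ) → Fin K}
    (hsel : ∀ t, Measurable (select t)) (μ μ' : Fin K → ℝ) :
    banditLaw (T := T) v select μ ≪ banditLaw (T := T) v select μ' ∧
    llr (banditLaw (T := T) v select μ) (banditLaw (T := T) v select μ')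
      =ᵐ[banditLaw (T := T) v select μ]
      fun y => martPart select μ (fun i => (μ i - μ' i) / v) y +
        ∑ i, (pullCount select y i : ℝ) * ((μ i - μ' i) ^ 2 / (2 * v)) := by
  have := banditLaw_prob hv hsel μ' T
  have mf := measurable_density (T := T) v hsel μ
  have mg := measurable_density (T := T) v hsel μ'
  set f := (fun y : Fin T → ℝ =>
      ∏ t, ENNReal.ofReal (gaussianPDFReal (μ (armProc select y t)) v (y t))) with hf
  set g := (fun y : Fin T → ℝ =>
      ∏ t, ENNReal.ofReal (gaussianPDFReal (μ' (armProc select y t)) v (y t))) with hg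
  have g0 : ∀ y, g y ≠ 0 := fun y => Finset.prod_ne_zero_iff.2 fun t _ => by
    simpa using gaussianPDFReal_pos _ _ _ hv
  have gt : ∀ y, g y ≠ ⊤ := fun y => ENNReal.prod_ne_top fun t _ => ENNReal.ofReal_ne_top
  have hPQ : banditLaw (T := T) v select μ
      = (banditLaw (T := T) v select μ').withDensity (fun y => f y / g y) := by
    unfold banditLaw
    refine Eq.trans ?_ (withDensity_mul _ mg (mf.div mg))
    congr 1
    funext y
    exact (ENNReal.mul_div_cancel (g0 y) (gt y)).symm
  have hac : banditLaw (T := T) v select μ ≪ banditLaw (T := T) v select μ' := by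
    rw [hPQ]; exact withDensity_absolutelyContinuous _ _
  refine ⟨hac, ?_⟩
  have hrn : (banditLaw (T := T) v select μ).rnDeriv (banditLaw (T := T) v select μ')
      =ᵐ[banditLaw (T := T) v select μ'] fun y => f y / g y := by
    rw [hPQ]; exact Measure.rnDeriv_withDensity _ (mf.div mg)
  filter_upwards [hac.ae_le hrn] with y hy
  rw [llr, hy, ENNReal.toReal_div, hf, hg]
  simp only [ENNReal.toReal_prod, ENNReal.toReal_ofReal (gaussianPDFReal_nonneg _ _ _)]
  have hp (ν : Fin K → ℝ) (t : Fin T) : gaussianPDFReal (ν (armProc select y t)) v (y t) ≠ 0 :=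
    (gaussianPDFReal_pos _ _ _ hv).ne'
  rw [Real.log_div (Finset.prod_ne_zero_iff.2 fun t _ => hp μ t)
    (Finset.prod_ne_zero_iff.2 fun t _ => hp μ' t), Real.log_prod (fun t _ => hp μ t),
    Real.log_prod (fun t _ => hp μ' t), ← Finset.sum_sub_distrib]
  simp only [log_pdf_sub hv, Finset.sum_add_distrib, martPart]
  congr 1
  rw [← Finset.sum_fiberwise Finset.univ (fun t => armProc select y t)]
  refine Finset.sum_congr rfl fun i _ => ?_
  rw [Finset.sum_congr rfl (g := fun _ => (μ i - μ' i) ^ 2 / (2 * (v : ℝ)))]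
  · simp [pullCount]
  · intro t ht
    rw [(Finset.mem_filter.1 ht).2]

theorem integrable_pullCount {K T : ℕ} {v : NNReal} (hv : v ≠ 0)
    {select : (t : ℕ) → (Fin t → ℝ) → Fin K}
    (hsel : ∀ t, Measurable (select t)) (μ : Fin K → ℝ) (i : Fin K) :
    Integrable (fun y : Fin T → ℝ => (pullCount select y i : ℝ))
      (banditLaw (T := T) v select μ) := by
  have := banditLaw_prob hv hsel μ T
  have hm : Measurable (fun y : Fin T → ℝ => (pullCount select y i : ℝ)) := by
    have : (fun y : Fin T → ℝ => (pullCount select y i : ℝ)) =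
        fun y => ∑ t, (fun j => if j = i then (1 : ℝ) else 0) (armProc select y t) := by
      funext y; simp [pullCount]
    rw [this]
    exact Finset.measurable_sum _ fun t _ =>
      (measurable_of_countable (fun j : Fin K => if j = i then (1 : ℝ) else 0)).comp
        (measurable_armProc hsel t)
  refine Integrable.of_bound hm.aestronglyMeasurable T (Filter.Eventually.of_forall fun y => ?_)
  rw [Real.norm_natCast, Nat.cast_le, pullCount]
  exact (Finset.card_filter_le _ _).trans (by simp)

theorem klDiv_bandit_general {K T : ℕ} {v : NNReal} (hv : v ≠ 0)
    {select : (t : ℕ) → (Fin t → ℝ) → Fin K}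
    (hsel : ∀ t, Measurable (select t)) (μ μ' : Fin K → ℝ) :
    klDiv (banditLaw (T := T) v select μ) (banditLaw (T := T) v select μ') =
      ((∑ i : Fin K,
        (∫ y, (pullCount select y i : ℝ) ∂(banditLaw (T := T) v select μ)) *
          ((μ i - μ' i) ^ 2 / (2 * (v : ℝ))) : ℝ) : EReal) := by
  obtain ⟨hac, hllr⟩ := bandit_ac_llr (T := T) hv hsel μ μ'
  obtain ⟨i1, e1⟩ := martPart_integral hv hsel μ (fun i => (μ i - μ' i) / (v : ℝ)) T
  have i2 : ∀ i ∈ (Finset.univ : Finset (Fin K)),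
      Integrable (fun y : Fin T → ℝ => (pullCount select y i : ℝ) *
        ((μ i - μ' i) ^ 2 / (2 * (v : ℝ)))) (banditLaw (T := T) v select μ) :=
    fun i _ => (integrable_pullCount hv hsel μ i).mul_const _
  have i3 := integrable_finsetSum _ i2
  rw [klDiv, if_pos ⟨hac, (integrable_congr hllr).2 (i1.add i3)⟩, integral_congr_ae hllr,
    integral_add i1 i3, e1, zero_add, integral_finsetSum _ i2]
  simp only [integral_mul_const]

/-- Chain rule for the KL divergence between bandit transcript laws: for any
two mean vectors `μ, μ'`, `KL(P_μ ‖ P_{μ'}) = ∑_i E_{P_μ}[N_i]·(μ_i − μ'_i)²/(2σ²)`, where `N_i`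
is the number of rounds at which arm `i` is pulled. In particular, if `μ` and `μ'` differ only in
arm `i`, then `KL(P_μ ‖ P_{μ'}) = ((μ_i − μ'_i)²/(2σ²))·E_{P_μ}[N_i]`. -/
theorem bandit_transcript_klDiv (K T : ℕ) (hK : 1 ≤ K) (σ : ℝ) (hσ : 0 < σ)
    (select : (t : ℕ) → (Fin t → ℝ) → Fin K) (hsel : ∀ t, Measurable (select t))
    (μ μ' : Fin K → ℝ) :
    klDiv (banditLaw (T := T) ⟨σ ^ 2, sq_nonneg σ⟩ select μ)
        (banditLaw (T := T) ⟨σ ^ 2, sq_nonneg σ⟩ select μ') =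
      ((∑ i : Fin K,
        (∫ y, (pullCount select y i : ℝ)
            ∂(banditLaw (T := T) ⟨σ ^ 2, sq_nonneg σ⟩ select μ)) *
          ((μ i - μ' i) ^ 2 / (2 * σ ^ 2)) : ℝ) : EReal) ∧
    ∀ i : Fin K, (∀ j, j ≠ i → μ j = μ' j) →
      klDiv (banditLaw (T := T) ⟨σ ^ 2, sq_nonneg σ⟩ select μ)
          (banditLaw (T := T) ⟨σ ^ 2, sq_nonneg σ⟩ select μ') =
        ((((μ i - μ' i) ^ 2 / (2 * σ ^ 2)) *
          ∫ y, (pullCount select y i : ℝ)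
            ∂(banditLaw (T := T) ⟨σ ^ 2, sq_nonneg σ⟩ select μ) : ℝ) : EReal) := by
  have hv : (⟨σ ^ 2, sq_nonneg σ⟩ : NNReal) ≠ 0 := by
    intro h
    have h2 := congrArg NNReal.toReal h
    have : σ ^ 2 = 0 := h2
    exact absurd this (by positivity)
  have hmain : klDiv (banditLaw (T := T) ⟨σ ^ 2, sq_nonneg σ⟩ select μ)
        (banditLaw (T := T) ⟨σ ^ 2, sq_nonneg σ⟩ select μ') =
      ((∑ i : Fin K,
        (∫ y, (pullCount select y i : ℝ)
            ∂(banditLaw (T := T) ⟨σ ^ 2, sq_nonneg σ⟩ select μ)) *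
          ((μ i - μ' i) ^ 2 / (2 * σ ^ 2)) : ℝ) : EReal) := by
    exact klDiv_bandit_general hv hsel μ μ'
  refine ⟨hmain, fun i hi => ?_⟩
  rw [hmain, Finset.sum_eq_single i]
  · rw [mul_comm]
  · intro j _ hj
    simp [hi j hj]
  · simp
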